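/- arXiv:2408.11725 — 3 statements merged into one kernel-verified Lean document; each statement's English description precedes it below -/
import Mathlib

section
/- Let P_1, …, P_N be Markov kernels on a measurable space (X, ℬ), let ε > 0 and q ∈ [ε,1]^N. Then the multiple random-scan kernel dominates the systematic-scan kernel: P_q(x,A) ≥ ε^N P_GS(x,A) for all x ∈ X and A ∈ ℬ. In particular, the weight of the full subset satisfies w_{{1,…,N}}(q) = (∏_{i=1}^N q_i) / (1 − ∏_{i=1}^N (1 − q_i)) ≥ ∏_{i=1}^N q_i ≥ ε^N. -/
open MeasureTheory ProbabilityTheory Filter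
open scoped ENNReal

/-- Total variation distance between two measures:
`‖μ − ν‖_TV = sup_{A ∈ ℬ} |μ(A) − ν(A)|`. -/
noncomputable def tvDist {X : Type*} [MeasurableSpace X] (μ ν : Measure X) : ℝ :=
  ⨆ A : {s : Set X // MeasurableSet s}, |(μ A.1).toReal - (ν A.1).toReal|

/-- `n`-fold composition of a kernel with itself (`kpow P 0` is the identity kernel).
Recall `η ∘ₖ κ` applies `κ` first and then `η`. -/
noncomputable def kpow {X : Type*} [MeasurableSpace X] (P : Kernel X X) : ℕ → Kernel X X
  | 0 => Kernel.id
  | n + 1 => kpow P n ∘ₖ P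

/-- Composition of a list of kernels, applying them in the order of the list. -/
noncomputable def seqComp {X : Type*} [MeasurableSpace X] (l : List (Kernel X X)) : Kernel X X :=
  l.foldl (fun acc κ => κ ∘ₖ acc) Kernel.id

/-- The composed kernel `P_S` for a subset `S ⊆ {1,…,N}`, applying the kernels of `S` in
increasing index order. -/
noncomputable def subsetComp {X : Type*} [MeasurableSpace X] {N : ℕ}
    (P : Fin N → Kernel X X) (S : Finset (Fin N)) : Kernel X X :=
  seqComp ((S.sort (· ≤ ·)).map P)

/-- The systematic-scan (Gibbs) kernel `P_GS = P_1 P_2 ⋯ P_N`. -/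
noncomputable def gsKernel {X : Type*} [MeasurableSpace X] {N : ℕ}
    (P : Fin N → Kernel X X) : Kernel X X :=
  subsetComp P Finset.univ

/-- Selection weight `w_S(q)` of a nonempty subset `S` in the multiple random-scan scheme:
`w_S(q) = (∏_{i∈S} q_i ∏_{i∉S} (1 − q_i)) / (1 − ∏_i (1 − q_i))`. -/
noncomputable def selWeight {N : ℕ} (q : Fin N → ℝ) (S : Finset (Fin N)) : ℝ :=
  ((∏ i ∈ S, q i) * ∏ i ∈ Sᶜ, (1 - q i)) / (1 - ∏ i, (1 - q i))

/-- Scalar multiple of a kernel by an extended nonnegative real. -/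
noncomputable def kSMul {X : Type*} [MeasurableSpace X] (c : ℝ≥0∞) (κ : Kernel X X) :
    Kernel X X :=
  ⟨fun x => c • κ x, Measure.measurable_of_measurable_coe _ (fun s hs => by
    simp_rw [Measure.smul_apply, smul_eq_mul]
    exact (κ.measurable_coe hs).const_mul c)⟩

/-- The multiple random-scan kernel `P_q = Σ_{∅≠S⊆{1,…,N}} w_S(q) P_S`. -/
noncomputable def mrsKernel {X : Type*} [MeasurableSpace X] {N : ℕ}
    (P : Fin N → Kernel X X) (q : Fin N → ℝ) : Kernel X X :=
  ∑ S ∈ Finset.univ.filter (fun S : Finset (Fin N) => S.Nonempty),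
    kSMul (ENNReal.ofReal (selWeight q S)) (subsetComp P S)

/-- The single-coordinate random-scan kernel `P_p = Σ_{i=1}^N p_i P_i`. -/
noncomputable def rsKernel {X : Type*} [MeasurableSpace X] {N : ℕ}
    (P : Fin N → Kernel X X) (p : Fin N → ℝ) : Kernel X X :=
  ∑ i : Fin N, kSMul (ENNReal.ofReal (p i)) (P i)

/-- The Dobrushin contraction coefficient `β(P) = sup_{x,y} ‖P(x,·) − P(y,·)‖_TV`. -/
noncomputable def dobrushin {X : Type*} [MeasurableSpace X] (P : Kernel X X) : ℝ :=
  ⨆ x : X, ⨆ y : X, tvDist (P x) (P y)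

/-- A kernel `P` with target probability measure `π` is uniformly ergodic if
`sup_x ‖P^n(x,·) − π‖_TV ≤ M ρ^n` for some `M ≥ 0` and `ρ ∈ [0,1)` and all `n ≥ 1`. -/
def UniformlyErgodic {X : Type*} [MeasurableSpace X] (P : Kernel X X) (π : Measure X) : Prop :=
  ∃ M ρ : ℝ, 0 ≤ M ∧ 0 ≤ ρ ∧ ρ < 1 ∧
    ∀ n : ℕ, 1 ≤ n → ∀ x : X, tvDist (kpow P n x) π ≤ M * ρ ^ n

theorem mrsKernel_apply {X : Type*} [MeasurableSpace X] {N : ℕ}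
    (P : Fin N → Kernel X X) (q : Fin N → ℝ) (x : X) (A : Set X) :
    mrsKernel P q x A = ∑ S ∈ Finset.univ.filter (fun S : Finset (Fin N) => S.Nonempty),
      ENNReal.ofReal (selWeight q S) * subsetComp P S x A := by
  rw [mrsKernel, Kernel.finsetSum_apply']
  rfl

/-- The weight of the full subset is at least the product of the selection probabilities. -/
theorem prod_le_selWeight_univ {N : ℕ} (hN : 1 ≤ N) (q : Fin N → ℝ)
    (hq : ∀ i, 0 < q i ∧ q i ≤ 1) : ∏ i, q i ≤ selWeight q Finset.univ := by
  have : NeZero N := ⟨by omega⟩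
  have h_nonneg : 0 ≤ ∏ i, (1 - q i) :=
    Finset.prod_nonneg fun i _ => sub_nonneg.2 (hq i).2
  have h_lt : ∏ i, (1 - q i) < 1 :=
    calc ∏ i, (1 - q i) ≤ ∏ i ∈ {(0 : Fin N)}, (1 - q i) :=
          Finset.prod_le_prod_of_subset_of_le_one (Finset.subset_univ _)
            (fun i _ => sub_nonneg.2 (hq i).2) fun i _ _ => by linarith [(hq i).1]
      _ < 1 := by simpa using (hq 0).1
  have h_prod : 0 ≤ ∏ i, q i := Finset.prod_nonneg fun i _ => (hq i).1.le
  rw [selWeight, Finset.compl_univ, Finset.prod_empty, mul_one]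
  exact le_div_self h_prod (by linarith) (by linarith)

/-- For `ε > 0` and `q ∈ [ε,1]^N`, the multiple random-scan kernel
dominates the systematic-scan kernel: `P_q(x,A) ≥ ε^N P_GS(x,A)`; in particular the
weight of the full subset satisfies `w_{{1,…,N}}(q) ≥ ∏_i q_i ≥ ε^N`. -/
theorem mrs_dominates_gs
    {X : Type*} [MeasurableSpace X] {N : ℕ} (hN : 1 ≤ N)
    (P : Fin N → Kernel X X) (hP : ∀ i, IsMarkovKernel (P i))
    (ε : ℝ) (hε : 0 < ε) (q : Fin N → ℝ) (hq : ∀ i, ε ≤ q i ∧ q i ≤ 1) :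
    (∀ x : X, ∀ A : Set X, MeasurableSet A →
      ENNReal.ofReal (ε ^ N) * gsKernel P x A ≤ mrsKernel P q x A) ∧
    ε ^ N ≤ ∏ i, q i ∧ (∏ i, q i) ≤ selWeight q Finset.univ := by
  have : NeZero N := ⟨by omega⟩
  have h_eps : ε ^ N ≤ ∏ i, q i := by
    simpa using Finset.prod_le_prod (s := Finset.univ) (f := fun _ : Fin N => ε)
      (fun _ _ => hε.le) fun i _ => (hq i).1
  have h_weight : ∏ i, q i ≤ selWeight q Finset.univ :=
    prod_le_selWeight_univ hN q fun i => ⟨hε.trans_le (hq i).1, (hq i).2⟩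
  refine ⟨fun x A _ => ?_, h_eps, h_weight⟩
  rw [mrsKernel_apply]
  calc ENNReal.ofReal (ε ^ N) * gsKernel P x A
      ≤ ENNReal.ofReal (selWeight q Finset.univ) * subsetComp P Finset.univ x A :=
        mul_le_mul' (ENNReal.ofReal_le_ofReal (h_eps.trans h_weight)) le_rfl
    _ ≤ _ := Finset.single_le_sum
        (f := fun S => ENNReal.ofReal (selWeight q S) * subsetComp P S x A)
        (fun _ _ => zero_le) (by simp [Finset.univ_nonempty])
end

section
/- Let P be a Markov kernel on a measurable space (X, ℬ) with invariant probability measure π, and suppose there exist an integer m ≥ 1, δ ∈ (0,1], and a probability measure ν such that P^m(x,A) ≥ δ ν(A) for all x ∈ X and A ∈ ℬ. Then for every n ≥ 0, sup_{x∈X} ‖P^n(x,·) − π‖_TV ≤ (1 − δ)^{⌊n/m⌋}; in particular, P is uniformly ergodic with invariant distribution π. -/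
open MeasureTheory ProbabilityTheory Filter
open scoped ENNReal

/-- Integrals against a probability measure dominating `δ • ν` differ from `δ * ∫ f ∂ν` by a
quantity controlled by the bounds of `f`. -/
lemma integral_mem_Icc_of_smul_le {X : Type*} [MeasurableSpace X] {μ ν : Measure X}
    [IsProbabilityMeasure μ] [IsProbabilityMeasure ν] {δ : ℝ} (hδ : 0 ≤ δ)
    (h : ENNReal.ofReal δ • ν ≤ μ) {f : X → ℝ} (hf : Measurable f) {c d : ℝ}
    (hfc : ∀ x, f x ∈ Set.Icc c d) :
    ∫ x, f x ∂μ ∈ Set.Icc (δ * ∫ x, f x ∂ν + (1 - δ) * c) (δ * ∫ x, f x ∂ν + (1 - δ) * d) := by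
  have integrable (η : Measure X) [IsProbabilityMeasure η] : Integrable f η :=
    Integrable.of_mem_Icc c d hf.aemeasurable (ae_of_all _ hfc)
  have hlow := integral_mono_measure h (ae_of_all _ fun x => sub_nonneg.2 (hfc x).1)
    ((integrable μ).sub (integrable_const c))
  have hup := integral_mono_measure h (ae_of_all _ fun x => sub_nonneg.2 (hfc x).2)
    ((integrable_const d).sub (integrable μ))
  rw [integral_smul_measure, integral_sub (integrable _) (integrable_const _),
    integral_sub (integrable _) (integrable_const _)] at hlow
  rw [integral_smul_measure, integral_sub (integrable_const _) (integrable _),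
    integral_sub (integrable_const _) (integrable _)] at hup
  simp only [ENNReal.toReal_ofReal hδ, integral_const, probReal_univ, smul_eq_mul, one_mul]
    at hlow hup
  constructor <;> linarith

lemma kpow_eq_pow {X : Type*} [MeasurableSpace X] (P : Kernel X X) (n : ℕ) : kpow P n = P ^ n := by
  induction n with
  | zero => rfl
  | succ n ih => rw [kpow, ih, pow_succ]; rfl

instance isMarkovKernel_kpow {X : Type*} [MeasurableSpace X] (P : Kernel X X) [IsMarkovKernel P]
    (n : ℕ) : IsMarkovKernel (kpow P n) := by
  induction n with
  | zero => rw [kpow]; infer_instance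
  | succ n ih => rw [kpow]; infer_instance

lemma bind_kpow {X : Type*} [MeasurableSpace X] {P : Kernel X X} {π : Measure X}
    (hinv : π.bind P = π) (n : ℕ) : π.bind (kpow P n) = π := by
  induction n with
  | zero => rw [kpow]; exact Measure.id_comp
  | succ n ih => rw [kpow, ← Measure.comp_assoc, hinv, ih]

lemma measureReal_bind_eq_integral {X Y : Type*} [MeasurableSpace X] [MeasurableSpace Y]
    (μ : Measure X) (κ : Kernel X Y) [IsMarkovKernel κ] {A : Set Y} (hA : MeasurableSet A) :
    (μ.bind κ).real A = ∫ x, (κ x).real A ∂μ := by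
  rw [measureReal_def, Measure.bind_apply hA κ.aemeasurable]
  exact (integral_toReal (κ.measurable_coe hA).aemeasurable
    (ae_of_all _ fun x => measure_lt_top _ _)).symm

/-- Under a minorization condition for `P ^ m`, the oscillation of `x ↦ P ^ n (x, A)` is at most
`(1 - δ) ^ (n / m)`. -/
lemma exists_kpow_mem_Icc {X : Type*} [MeasurableSpace X] (P : Kernel X X) [IsMarkovKernel P]
    {m : ℕ} (hm : 1 ≤ m) {δ : ℝ} (hδ0 : 0 ≤ δ) (hδ1 : δ ≤ 1) {ν : Measure X}
    [IsProbabilityMeasure ν] (hminor : ∀ x, ENNReal.ofReal δ • ν ≤ kpow P m x)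
    {A : Set X} (hA : MeasurableSet A) (n : ℕ) :
    ∃ c d : ℝ, d - c ≤ (1 - δ) ^ (n / m) ∧ ∀ x, (kpow P n x).real A ∈ Set.Icc c d := by
  induction n using Nat.strong_induction_on with
  | _ n ih =>
    rcases lt_or_ge n m with hn | hn
    · exact ⟨0, 1, by simp [Nat.div_eq_of_lt hn], fun x => ⟨measureReal_nonneg, measureReal_le_one⟩⟩
    · obtain ⟨c, d, hcd, hmem⟩ := ih (n - m) (by lia)
      refine ⟨δ * ∫ y, (kpow P (n - m) y).real A ∂ν + (1 - δ) * c,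
        δ * ∫ y, (kpow P (n - m) y).real A ∂ν + (1 - δ) * d, ?_, fun x => ?_⟩
      · rw [Nat.div_eq_sub_div hm hn, pow_succ]
        nlinarith [mul_le_mul_of_nonneg_left hcd (sub_nonneg.2 hδ1)]
      · have hsplit : kpow P n x = (kpow P m x).bind (kpow P (n - m)) := by
          rw [← Kernel.comp_apply, kpow_eq_pow, kpow_eq_pow, kpow_eq_pow]
          conv_lhs => rw [← Nat.sub_add_cancel hn, pow_add]
          rfl
        rw [hsplit, measureReal_bind_eq_integral _ _ hA]
        exact integral_mem_Icc_of_smul_le hδ0 (hminor x)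
          ((kpow P (n - m)).measurable_coe hA).ennreal_toReal hmem

/-- A step-function geometric bound is dominated by a genuine geometric bound. -/
lemma exists_pow_div_le_mul_pow {a : ℝ} (ha0 : 0 ≤ a) (ha1 : a < 1) {m : ℕ} (hm : 1 ≤ m) :
    ∃ M ρ : ℝ, 0 ≤ M ∧ 0 ≤ ρ ∧ ρ < 1 ∧ ∀ n : ℕ, a ^ (n / m) ≤ M * ρ ^ n := by
  obtain ⟨b, hab, hb1⟩ := exists_between ha1
  have hb0 : 0 < b := ha0.trans_lt hab
  set ρ : ℝ := b ^ (m : ℝ)⁻¹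
  have hρ0 : 0 ≤ ρ := Real.rpow_nonneg hb0.le _
  have hρm : ρ ^ m = b := Real.rpow_inv_natCast_pow hb0.le (by lia)
  have hρ1 : ρ < 1 := Real.rpow_lt_one hb0.le hb1 (by positivity)
  refine ⟨b⁻¹, ρ, by positivity, hρ0, hρ1, fun n => ?_⟩
  calc a ^ (n / m) ≤ b ^ (n / m) := by gcongr
    _ = b⁻¹ * (b ^ (n / m) * ρ ^ m) := by rw [hρm]; field_simp
    _ ≤ b⁻¹ * (b ^ (n / m) * ρ ^ (n % m)) := by
      have := pow_le_pow_of_le_one hρ0 hρ1.le (Nat.mod_lt n hm).le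
      gcongr
    _ = b⁻¹ * ρ ^ n := by
      conv_rhs => rw [← Nat.div_add_mod n m, pow_add, pow_mul, hρm]

/-- If `π` is invariant for `P` and `P^m(x,A) ≥ δ ν(A)` for all
`x, A`, then `sup_x ‖P^n(x,·) − π‖_TV ≤ (1 − δ)^{⌊n/m⌋}` for all `n ≥ 0`;
in particular `P` is uniformly ergodic with invariant distribution `π`. -/
theorem minorization_implies_uniform_ergodicity
    {X : Type*} [MeasurableSpace X]
    (P : Kernel X X) (hP : IsMarkovKernel P)
    (π : Measure X) [IsProbabilityMeasure π] (hinv : π.bind P = π)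
    (m : ℕ) (hm : 1 ≤ m) (δ : ℝ) (hδ0 : 0 < δ) (hδ1 : δ ≤ 1)
    (ν : Measure X) [IsProbabilityMeasure ν]
    (hminor : ∀ x : X, ∀ A : Set X, MeasurableSet A →
      ENNReal.ofReal δ * ν A ≤ kpow P m x A) :
    (∀ n : ℕ, ∀ x : X, tvDist (kpow P n x) π ≤ (1 - δ) ^ (n / m)) ∧
      UniformlyErgodic P π := by
  have hbound : ∀ n : ℕ, ∀ x : X, tvDist (kpow P n x) π ≤ (1 - δ) ^ (n / m) := by
    intro n x
    have hle : ∀ x, ENNReal.ofReal δ • ν ≤ kpow P m x := fun x =>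
      Measure.le_iff.2 fun A hA => hminor x A hA
    have : Nonempty {s : Set X // MeasurableSet s} := ⟨⟨∅, MeasurableSet.empty⟩⟩
    refine ciSup_le fun ⟨A, hA⟩ => ?_
    obtain ⟨c, d, hcd, hmem⟩ := exists_kpow_mem_Icc P hm hδ0.le hδ1 hle hA n
    have hπ : π.real A ∈ Set.Icc c d := by
      have h := integral_mem_Icc_of_smul_le (μ := π) (ν := π) le_rfl
        (by simp [Measure.zero_le]) ((kpow P n).measurable_coe hA).ennreal_toReal hmem
      rw [← bind_kpow hinv n, measureReal_bind_eq_integral _ _ hA]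
      simpa [measureReal_def] using h
    exact (abs_sub_le_of_le_of_le (hmem x).1 (hmem x).2 hπ.1 hπ.2).trans hcd
  refine ⟨hbound, ?_⟩
  obtain ⟨M, ρ, hM, hρ0, hρ1, h⟩ :=
    exists_pow_div_le_mul_pow (sub_nonneg.2 hδ1) (sub_lt_self 1 hδ0) hm
  exact ⟨M, ρ, hM, hρ0, hρ1, fun n _ x => (hbound n x).trans (h n)⟩
end

section
/- Let P_1, …, P_N be Markov kernels on a measurable space (X, ℬ), let ε ∈ (0,1], and let (q^{(h)})_{h≥0} be a sequence in [ε,1]^N with ‖q^{(h)} − q^{(h−1)}‖_∞ → 0 as h → ∞. Then the corresponding multiple random-scan kernels satisfy the diminishing-adaptation property: sup_{x∈X} ‖P_{q^{(h)}}(x,·) − P_{q^{(h−1)}}(x,·)‖_TV → 0 as h → ∞. -/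
open MeasureTheory ProbabilityTheory Filter
open scoped ENNReal

theorem isMarkovKernel_foldl_comp {X : Type*} [MeasurableSpace X] (l : List (Kernel X X))
    (hl : ∀ κ ∈ l, IsMarkovKernel κ) (acc : Kernel X X) (hacc : IsMarkovKernel acc) :
    IsMarkovKernel (l.foldl (fun acc κ => κ ∘ₖ acc) acc) := by
  induction l generalizing acc with
  | nil => exact hacc
  | cons κ l ih =>
    have := hl κ (by simp)
    exact ih (fun κ' h => hl κ' (by simp [h])) (κ ∘ₖ acc) inferInstance

theorem isMarkovKernel_subsetComp {X : Type*} [MeasurableSpace X] {N : ℕ}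
    (P : Fin N → Kernel X X) (hP : ∀ i, IsMarkovKernel (P i)) (S : Finset (Fin N)) :
    IsMarkovKernel (subsetComp P S) := by
  refine isMarkovKernel_foldl_comp _ (fun κ hκ => ?_) Kernel.id inferInstance
  obtain ⟨i, -, rfl⟩ := List.mem_map.1 hκ
  exact hP i

theorem mrsKernel_apply_toReal {X : Type*} [MeasurableSpace X] {N : ℕ}
    (P : Fin N → Kernel X X) (hP : ∀ i, IsMarkovKernel (P i)) (q : Fin N → ℝ) (x : X)
    (A : Set X) :
    (mrsKernel P q x A).toReal = ∑ S ∈ Finset.univ.filter (fun S : Finset (Fin N) => S.Nonempty),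
      max (selWeight q S) 0 * (subsetComp P S x A).toReal := by
  have := isMarkovKernel_subsetComp P hP
  rw [mrsKernel, Kernel.finsetSum_apply', ENNReal.toReal_sum]
  · refine Finset.sum_congr rfl fun S _ => ?_
    change (ENNReal.ofReal (selWeight q S) * subsetComp P S x A).toReal = _
    rw [ENNReal.toReal_mul, ENNReal.toReal_ofReal']
  · intro S _
    change ENNReal.ofReal (selWeight q S) * subsetComp P S x A ≠ ⊤
    exact ENNReal.mul_ne_top ENNReal.ofReal_ne_top (measure_ne_top _ _)

theorem tvDist_mrsKernel_le {X : Type*} [MeasurableSpace X] {N : ℕ}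
    (P : Fin N → Kernel X X) (hP : ∀ i, IsMarkovKernel (P i)) (q q' : Fin N → ℝ) (x : X) :
    tvDist (mrsKernel P q x) (mrsKernel P q' x) ≤
      ∑ S ∈ Finset.univ.filter (fun S : Finset (Fin N) => S.Nonempty),
        |selWeight q S - selWeight q' S| := by
  have := isMarkovKernel_subsetComp P hP
  refine Real.iSup_le (fun A => ?_) (Finset.sum_nonneg fun _ _ => abs_nonneg _)
  rw [mrsKernel_apply_toReal P hP, mrsKernel_apply_toReal P hP, ← Finset.sum_sub_distrib]
  refine (Finset.abs_sum_le_sum_abs _ _).trans (Finset.sum_le_sum fun S _ => ?_)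
  rw [← sub_mul, abs_mul, abs_of_nonneg ENNReal.toReal_nonneg]
  exact (mul_le_of_le_one_right (abs_nonneg _) measureReal_le_one).trans
    (abs_max_sub_max_le_abs _ _ _)

theorem continuousOn_selWeight {N : ℕ} {ε : ℝ} (hε : 0 < ε) {S : Finset (Fin N)}
    (hS : S.Nonempty) :
    ContinuousOn (fun q => selWeight q S) (Set.Icc (fun _ : Fin N => ε) (fun _ => 1)) := by
  unfold selWeight
  refine ContinuousOn.div (by fun_prop) (by fun_prop) fun q hq => ?_
  obtain ⟨i, -⟩ := hS
  have h_lt : ∏ j, (1 - q j) < 1 := by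
    rw [← Finset.mul_prod_erase _ _ (Finset.mem_univ i)]
    have h_le : ∏ j ∈ Finset.univ.erase i, (1 - q j) ≤ 1 :=
      Finset.prod_le_one (fun j _ => sub_nonneg.2 (hq.2 j))
        fun j _ => by linarith [show ε ≤ q j from hq.1 j]
    have hi : ε ≤ q i := hq.1 i
    have hi' : q i ≤ 1 := hq.2 i
    nlinarith
  exact (sub_pos.2 h_lt).ne'

theorem tendsto_selWeight_sub {N : ℕ} {ε : ℝ} (hε : 0 < ε) {S : Finset (Fin N)}
    (hS : S.Nonempty) {ι : Type*} {l : Filter ι} {q q' : ι → Fin N → ℝ}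
    (hq : ∀ h, q h ∈ Set.Icc (fun _ : Fin N => ε) (fun _ => 1))
    (hq' : ∀ h, q' h ∈ Set.Icc (fun _ : Fin N => ε) (fun _ => 1))
    (hdiff : Tendsto (fun h => ‖q h - q' h‖) l (nhds 0)) :
    Tendsto (fun h => |selWeight (q h) S - selWeight (q' h) S|) l (nhds 0) := by
  have huc := isCompact_Icc.uniformContinuousOn_of_continuous (continuousOn_selWeight hε hS)
  rw [Metric.uniformContinuousOn_iff] at huc
  refine Metric.tendsto_nhds.2 fun η hη => ?_
  obtain ⟨δ, hδ, H⟩ := huc η hη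
  filter_upwards [hdiff.eventually_lt_const hδ] with h hh
  simpa [Real.dist_eq] using H _ (hq h) _ (hq' h) (by rwa [dist_eq_norm])

/-- diminishing adaptation of the MRS kernels. If
`q^{(h)} ∈ [ε,1]^N` with `‖q^{(h)} − q^{(h−1)}‖_∞ → 0`, then
`sup_x ‖P_{q^{(h)}}(x,·) − P_{q^{(h−1)}}(x,·)‖_TV → 0`
(`‖·‖` on `Fin N → ℝ` is the sup norm). -/
theorem mrs_diminishing_adaptation
    {X : Type*} [MeasurableSpace X] {N : ℕ}
    (P : Fin N → Kernel X X) (hP : ∀ i, IsMarkovKernel (P i))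
    (ε : ℝ) (hε0 : 0 < ε) (hε1 : ε ≤ 1)
    (q : ℕ → Fin N → ℝ) (hq : ∀ h : ℕ, ∀ i, ε ≤ q h i ∧ q h i ≤ 1)
    (hdiff : Tendsto (fun h => ‖q h - q (h - 1)‖) atTop (nhds 0)) :
    Tendsto (fun h => ⨆ x : X,
        tvDist (mrsKernel P (q h) x) (mrsKernel P (q (h - 1)) x))
      atTop (nhds 0) := by
  have hmem : ∀ h, q h ∈ Set.Icc (fun _ : Fin N => ε) (fun _ => 1) :=
    fun h => ⟨fun i => (hq h i).1, fun i => (hq h i).2⟩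
  have hsum := tendsto_finsetSum (Finset.univ.filter fun S : Finset (Fin N) => S.Nonempty)
    fun S hS => tendsto_selWeight_sub hε0 (Finset.mem_filter.1 hS).2 hmem
      (fun h => hmem (h - 1)) hdiff
  rw [Finset.sum_const_zero] at hsum
  refine squeeze_zero (fun h => ?_) (fun h => ?_) hsum
  · exact Real.iSup_nonneg fun x => Real.iSup_nonneg fun A => abs_nonneg _
  · exact Real.iSup_le (fun x => tvDist_mrsKernel_le P hP _ _ x)
      (Finset.sum_nonneg fun _ _ => abs_nonneg _)
end
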